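/- arXiv:2412.11221 — 8 statements merged into one kernel-verified Lean document; each statement's English description precedes it below -/
import Mathlib

section
/- Let (X,d) be a compact metric space of diameter at most 1 and let F : X → 2^X be a continuous set-valued map with nonempty compact values. Then for each δ > 0 there is δ₁ > 0 such that whenever d(x,y) < δ₁, the Hausdorff distance between the fibers π₀⁻¹(x) and π₀⁻¹(y) in the orbit space Orb_r(X) is less than δ: ρ_H(π₀⁻¹(x), π₀⁻¹(y)) < δ. -/
open Metric Set

variable {X : Type*} [MetricSpace X]

/-- A set-valued map `F : X → 2^X` is *upper semicontinuous* if for every `x` and every open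
`U ⊇ F x` there is an open neighborhood `V` of `x` with `F y ⊆ U` for all `y ∈ V`. -/
def SVUpperSC (F : X → Set X) : Prop :=
  ∀ x : X, ∀ U : Set X, IsOpen U → F x ⊆ U →
    ∃ V : Set X, IsOpen V ∧ x ∈ V ∧ ∀ y ∈ V, F y ⊆ U

/-- A set-valued map is *lower semicontinuous* if for every `x` and every open `U` meeting
`F x` there is an open neighborhood `V` of `x` with `F y ∩ U ≠ ∅` for all `y ∈ V`. -/
def SVLowerSC (F : X → Set X) : Prop :=
  ∀ x : X, ∀ U : Set X, IsOpen U → (F x ∩ U).Nonempty →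
    ∃ V : Set X, IsOpen V ∧ x ∈ V ∧ ∀ y ∈ V, (F y ∩ U).Nonempty

/-- A set-valued map is *continuous* if it is both upper and lower semicontinuous. -/
def SVContinuous (F : X → Set X) : Prop := SVUpperSC F ∧ SVLowerSC F

/-- `F` has nonempty compact values. -/
def SVCompactValued (F : X → Set X) : Prop := ∀ x : X, (F x).Nonempty ∧ IsCompact (F x)

/-- Image of a set under a set-valued map: `F(U) = ⋃_{x ∈ U} F x`. -/
def SVImage (F : X → Set X) (U : Set X) : Set X := ⋃ x ∈ U, F x

/-- A set-valued map is *open* if it maps open sets to open sets. -/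
def SVOpen (F : X → Set X) : Prop := ∀ U : Set X, IsOpen U → IsOpen (SVImage F U)

/-- A set-valued map is *onto* if every point lies in some value. -/
def SVOnto (F : X → Set X) : Prop := ∀ y : X, ∃ x : X, y ∈ F x

/-- The inverse set-valued map `F⁻¹(x) = {z : x ∈ F z}`. -/
def SVInv (F : X → Set X) : X → Set X := fun x => {z | x ∈ F z}

/-- The orbit space `Orb_r(X) = {(x_n) : x_{n+1} ∈ F(x_n)}`. -/
def OrbR (F : X → Set X) : Set (ℕ → X) := {u | ∀ n : ℕ, u (n + 1) ∈ F (u n)}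

/-- The left orbit space `Orb_l(X) = {(…,x_{-1},x_0) : x_i ∈ F(x_{i+1})}`, encoded by
`u n = x_{-n}`, so the defining condition reads `u (n+1) ∈ F (u n)`. -/
def OrbL (F : X → Set X) : Set (ℕ → X) := {u | ∀ n : ℕ, u (n + 1) ∈ F (u n)}

/-- The inverse orbit space `Orb_inv(X) = {(x_n) : x_n ∈ F(x_{n+1})}`. -/
def OrbInv (F : X → Set X) : Set (ℕ → X) := {u | ∀ n : ℕ, u n ∈ F (u (n + 1))}

/-- The shift on sequences. -/
def shiftSeq (u : ℕ → X) : ℕ → X := fun n => u (n + 1)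

/-- The shift map `σ_rF : Orb_r(X) → Orb_r(X)`, `(x_n) ↦ (x_{n+1})`. -/
def sigmaR (F : X → Set X) : OrbR F → OrbR F :=
  fun u => ⟨shiftSeq u.1, fun n => u.2 (n + 1)⟩

/-- The shift map `σ_lF : Orb_l(X) → Orb_l(X)`, `(x_{-n}) ↦ (x_{-n-1})`, in the encoding
`u n = x_{-n}`. -/
def sigmaL (F : X → Set X) : OrbL F → OrbL F :=
  fun u => ⟨shiftSeq u.1, fun n => u.2 (n + 1)⟩

/-- The metric `ρ((x_n),(y_n)) = Σ_{n≥0} d(x_n,y_n)/2^{n+1}` on sequence space. -/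
noncomputable def rho (u v : ℕ → X) : ℝ := ∑' n : ℕ, dist (u n) (v n) / 2 ^ (n + 1)

/-- `ρ`-distance from a point to a set of sequences. -/
noncomputable def rhoInf (u : ℕ → X) (B : Set (ℕ → X)) : ℝ := sInf (rho u '' B)

/-- Hausdorff distance with respect to `ρ` between two sets of sequences. -/
noncomputable def rhoHaus (A B : Set (ℕ → X)) : ℝ :=
  max (sSup ((fun u => rhoInf u B) '' A)) (sSup ((fun v => rhoInf v A) '' B))

/-- The shadowing property for a set-valued map: every `δ`-pseudo-orbit
(`d(x_{n+1}, F(x_n)) < δ`) is `ε`-shadowed by an `F`-orbit. -/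
def SVShadowing (F : X → Set X) : Prop :=
  ∀ ε > (0 : ℝ), ∃ δ > (0 : ℝ), ∀ x : ℕ → X,
    (∀ n : ℕ, infDist (x (n + 1)) (F (x n)) < δ) →
    ∃ y : ℕ → X, (∀ n : ℕ, y (n + 1) ∈ F (y n)) ∧ ∀ n : ℕ, dist (x n) (y n) < ε

/-- The (single-valued) shadowing property for the shift `σ_rF` on `(Orb_r(X), ρ)`. -/
def ShiftShadowingR (F : X → Set X) : Prop :=
  ∀ ε > (0 : ℝ), ∃ δ > (0 : ℝ), ∀ z : ℕ → (ℕ → X),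
    (∀ n : ℕ, z n ∈ OrbR F) →
    (∀ n : ℕ, rho (shiftSeq (z n)) (z (n + 1)) < δ) →
    ∃ w ∈ OrbR F, ∀ n : ℕ, rho (shiftSeq^[n] w) (z n) < ε

/-- The (single-valued) shadowing property for the shift `σ_lF` on `(Orb_l(X), ρ)`. -/
def ShiftShadowingL (F : X → Set X) : Prop :=
  ∀ ε > (0 : ℝ), ∃ δ > (0 : ℝ), ∀ z : ℕ → (ℕ → X),
    (∀ n : ℕ, z n ∈ OrbL F) →
    (∀ n : ℕ, rho (shiftSeq (z n)) (z (n + 1)) < δ) →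
    ∃ w ∈ OrbL F, ∀ n : ℕ, rho (shiftSeq^[n] w) (z n) < ε

/-- `F` is expansive with expansive constant `δ`. -/
def SVExpansiveWith (F : X → Set X) (δ : ℝ) : Prop :=
  ∀ u ∈ OrbR F, ∀ v ∈ OrbR F, (∀ n : ℕ, dist (u n) (v n) < δ) → u 0 = v 0

/-- The shift `σ_rF` is expansive (as a single-valued map on `(Orb_r(X), ρ)`)
with expansive constant `c`. -/
def ShiftExpansiveWith (F : X → Set X) (c : ℝ) : Prop :=
  ∀ u ∈ OrbR F, ∀ v ∈ OrbR F,
    (∀ k : ℕ, rho (shiftSeq^[k] u) (shiftSeq^[k] v) ≤ c) → u = v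

/-- The induced set-valued map `F_inv` on `Orb_inv(X)`: `F_inv([x_n]) = F(x_0) × [x_n]`,
i.e. all sequences `(z, x_0, x_1, …)` with `z ∈ F(x_0)`. -/
def Finv (F : X → Set X) (u : ℕ → X) : Set (ℕ → X) :=
  {v | v 0 ∈ F (u 0) ∧ ∀ n : ℕ, v (n + 1) = u n}

/-- The shadowing property of `F_inv` as a set-valued map on `(Orb_inv(X), ρ)`. -/
def FinvShadowing (F : X → Set X) : Prop :=
  ∀ ε > (0 : ℝ), ∃ δ > (0 : ℝ), ∀ x : ℕ → (ℕ → X),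
    (∀ n : ℕ, x n ∈ OrbInv F) →
    (∀ n : ℕ, rhoInf (x (n + 1)) (Finv F (x n)) < δ) →
    ∃ y : ℕ → (ℕ → X), (∀ n : ℕ, y n ∈ OrbInv F) ∧
      (∀ n : ℕ, y (n + 1) ∈ Finv F (y n)) ∧ ∀ n : ℕ, rho (x n) (y n) < ε

/-- Iterates of a set-valued map: `F^0(x) = {x}`, `F^{k+1}(x) = ⋃_{z ∈ F^k(x)} F z`. -/
def SVIter (F : X → Set X) : ℕ → X → Set X
  | 0 => fun x => {x}
  | n + 1 => fun x => SVImage F (SVIter F n x)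

open Filter Topology

theorem SVUpperSC.eventually_exists_dist_lt {F : X → Set X} (hF : SVUpperSC F) (p : X) {ε : ℝ}
    (hε : 0 < ε) : ∀ᶠ x in 𝓝 p, ∀ a ∈ F x, ∃ b ∈ F p, dist a b < ε := by
  obtain ⟨V, hVo, hpV, hV⟩ :=
    hF p (thickening ε (F p)) isOpen_thickening (self_subset_thickening hε _)
  filter_upwards [hVo.mem_nhds hpV] with x hx a ha
  exact mem_thickening_iff.1 (hV x hx ha)

theorem SVLowerSC.eventually_exists_dist_lt {F : X → Set X} (hF : SVLowerSC F) {p : X}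
    (hp : IsCompact (F p)) {ε : ℝ} (hε : 0 < ε) :
    ∀ᶠ x in 𝓝 p, ∀ a ∈ F p, ∃ b ∈ F x, dist a b < ε := by
  refine hp.induction_on (p := fun s => ∀ᶠ x in 𝓝 p, ∀ a ∈ s, ∃ b ∈ F x, dist a b < ε)
    (by simp) (fun s t hst ht => ht.mono fun x hx a ha => hx a (hst ha)) ?_ ?_
  · intro s t hs ht
    filter_upwards [hs, ht] with x hxs hxt a ha
    exact ha.elim (hxs a) (hxt a)
  · intro c hc
    refine ⟨ball c (ε / 2), mem_nhdsWithin_of_mem_nhds (ball_mem_nhds c (half_pos hε)), ?_⟩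
    obtain ⟨V, hVo, hpV, hV⟩ :=
      hF p (ball c (ε / 2)) isOpen_ball ⟨c, hc, mem_ball_self (half_pos hε)⟩
    filter_upwards [hVo.mem_nhds hpV] with x hx a ha
    obtain ⟨b, hb, hbc⟩ := hV x hx
    refine ⟨b, hb, ?_⟩
    have := dist_triangle_right a b c
    rw [mem_ball] at ha hbc
    linarith

/-- A continuous compact-valued map on a compact space is uniformly continuous for the
Hausdorff distance. -/
theorem SVContinuous.exists_forall_dist_lt [CompactSpace X] {F : X → Set X}
    (hF : SVContinuous F) (hFc : SVCompactValued F) {ε : ℝ} (hε : 0 < ε) :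
    ∃ η > 0, ∀ x y : X, dist x y < η → ∀ a ∈ F x, ∃ b ∈ F y, dist a b < ε := by
  have h : ∀ p : X, ∃ r > 0, ∀ x ∈ ball p r,
      (∀ a ∈ F x, ∃ b ∈ F p, dist a b < ε / 2) ∧ ∀ a ∈ F p, ∃ b ∈ F x, dist a b < ε / 2 :=
    fun p => Metric.eventually_nhds_iff_ball.1
      ((hF.1.eventually_exists_dist_lt p (half_pos hε)).and
        (hF.2.eventually_exists_dist_lt (hFc p).2 (half_pos hε)))
  choose r hr hball using h
  obtain ⟨η, hη, hcover⟩ := lebesgue_number_lemma_of_metric (isCompact_univ (X := X))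
    (c := fun p => ball p (r p)) (fun _ => isOpen_ball)
    fun p _ => mem_iUnion.2 ⟨p, mem_ball_self (hr p)⟩
  refine ⟨η, hη, fun x y hxy a ha => ?_⟩
  obtain ⟨p, hp⟩ := hcover x (mem_univ x)
  obtain ⟨c, hc, hac⟩ := (hball p x (hp (mem_ball_self hη))).1 a ha
  obtain ⟨b, hb, hcb⟩ := (hball p y (hp (mem_ball'.2 hxy))).2 c hc
  exact ⟨b, hb, by linarith [dist_triangle a c b]⟩

theorem exists_mem_orbR {Y : Type*} {F : Y → Set Y} (hF : ∀ x, (F x).Nonempty) (x : Y) :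
    ∃ u ∈ OrbR F, u 0 = x := by
  choose f hf using hF
  refine ⟨fun n => f^[n] x, fun n => ?_, rfl⟩
  simpa only [Function.iterate_succ_apply'] using hf (f^[n] x)

theorem rho_nonneg (u v : ℕ → X) : 0 ≤ rho u v :=
  tsum_nonneg fun _ => by positivity

theorem hasSum_one_div_two_pow_succ : HasSum (fun n : ℕ => (1 : ℝ) / 2 ^ (n + 1)) 1 := by
  convert hasSum_geometric_two' (1 : ℝ) using 2 with n
  rw [pow_succ']
  field_simp

theorem summable_rho (hd : ∀ x y : X, dist x y ≤ 1) (u v : ℕ → X) :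
    Summable fun n : ℕ => dist (u n) (v n) / 2 ^ (n + 1) :=
  .of_nonneg_of_le (fun _ => by positivity) (fun n => by gcongr; exact hd _ _)
    hasSum_one_div_two_pow_succ.summable

theorem rho_le_one (hd : ∀ x y : X, dist x y ≤ 1) (u v : ℕ → X) : rho u v ≤ 1 :=
  hasSum_le (fun n => by gcongr; exact hd _ _) (summable_rho hd u v).hasSum
    hasSum_one_div_two_pow_succ

theorem rho_eq_head_add_shift (hd : ∀ x y : X, dist x y ≤ 1) (u v : ℕ → X) :
    rho u v = dist (u 0) (v 0) / 2 + rho (shiftSeq u) (shiftSeq v) / 2 := by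
  rw [rho, (summable_rho hd u v).tsum_eq_zero_add, rho, ← tsum_div_const]
  simp only [shiftSeq, zero_add, pow_one, pow_succ _ (_ + 1), div_div]

/-- Every orbit is `ρ`-close, up to `ε + 2⁻ᴺ`, to an orbit starting at any given point close
to its first entry. -/
theorem exists_orbR_rho_le [CompactSpace X] (hd : ∀ x y : X, dist x y ≤ 1) {F : X → Set X}
    (hF : SVContinuous F) (hFc : SVCompactValued F) (N : ℕ) {ε : ℝ} (hε : 0 < ε) :
    ∃ η > 0, ∀ x y : X, dist x y < η → ∀ u ∈ OrbR F, u 0 = x →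
      ∃ v ∈ OrbR F, v 0 = y ∧ rho u v ≤ ε + (1 / 2) ^ N := by
  induction N with
  | zero =>
    refine ⟨1, one_pos, fun x y _ u _ _ => ?_⟩
    obtain ⟨v, hv, hvy⟩ := exists_mem_orbR (fun x => (hFc x).1) y
    exact ⟨v, hv, hvy, by linarith [rho_le_one hd u v]⟩
  | succ N ih =>
    obtain ⟨η, hη, hN⟩ := ih
    obtain ⟨θ, hθ, hθF⟩ := hF.exists_forall_dist_lt hFc hη
    refine ⟨min θ ε, lt_min hθ hε, fun x y hxy u hu hux => ?_⟩
    obtain ⟨b, hb, hub⟩ := hθF x y (hxy.trans_le (min_le_left _ _)) (u 1) (hux ▸ hu 0)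
    obtain ⟨v, hv, hvb, huv⟩ := hN (u 1) b hub (shiftSeq u) (fun n => hu (n + 1)) rfl
    let w : ℕ → X := fun n => Nat.casesOn n y v
    refine ⟨w, ?_, rfl, ?_⟩
    · rintro (_ | n)
      · exact (show v 0 ∈ F y from hvb.symm ▸ hb)
      · exact hv n
    · have hw : dist (u 0) (w 0) < ε := hux ▸ hxy.trans_le (min_le_right _ _)
      have hs : rho (shiftSeq u) (shiftSeq w) ≤ ε + (1 / 2) ^ N := huv
      rw [rho_eq_head_add_shift hd, pow_succ]
      linarith

theorem rhoInf_le_rho {B : Set (ℕ → X)} (u : ℕ → X) {v : ℕ → X} (hv : v ∈ B) :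
    rhoInf u B ≤ rho u v :=
  csInf_le ⟨0, forall_mem_image.2 fun _ _ => rho_nonneg _ _⟩ (mem_image_of_mem _ hv)

theorem rhoHaus_le {A B : Set (ℕ → X)} {r : ℝ} (hr : 0 ≤ r)
    (hA : ∀ u ∈ A, ∃ v ∈ B, rho u v ≤ r) (hB : ∀ v ∈ B, ∃ u ∈ A, rho v u ≤ r) :
    rhoHaus A B ≤ r := by
  refine max_le (Real.sSup_le (forall_mem_image.2 fun u hu => ?_) hr)
    (Real.sSup_le (forall_mem_image.2 fun v hv => ?_) hr)
  · obtain ⟨v, hv, h⟩ := hA u hu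
    exact (rhoInf_le_rho u hv).trans h
  · obtain ⟨u, hu, h⟩ := hB v hv
    exact (rhoInf_le_rho v hu).trans h

/-- For a continuous set-valued map `F` with nonempty compact values on a
compact metric space of diameter at most 1, for each `δ > 0` there is `δ₁ > 0` such that
`d(x,y) < δ₁` implies `ρ_H(π₀⁻¹(x), π₀⁻¹(y)) < δ` in `Orb_r(X)`. -/
theorem fiber_hausdorff_continuity [CompactSpace X]
    (hdiam : diam (univ : Set X) ≤ 1)
    (F : X → Set X) (hF : SVContinuous F) (hFc : SVCompactValued F) :
    ∀ δ > (0 : ℝ), ∃ δ₁ > (0 : ℝ), ∀ x y : X, dist x y < δ₁ →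
      rhoHaus {u | u ∈ OrbR F ∧ u 0 = x} {u | u ∈ OrbR F ∧ u 0 = y} < δ := by
  intro δ hδ
  have hd (x y : X) : dist x y ≤ 1 :=
    (dist_le_diam_of_mem isCompact_univ.isBounded (mem_univ x) (mem_univ y)).trans hdiam
  obtain ⟨N, hN⟩ := exists_pow_lt_of_lt_one (half_pos hδ) (one_half_lt_one (α := ℝ))
  obtain ⟨η, hη, h⟩ := exists_orbR_rho_le hd hF hFc N (half_pos hδ)
  refine ⟨η, hη, fun x y hxy => ?_⟩
  refine (rhoHaus_le (r := δ / 2 + (1 / 2) ^ N) (by positivity) ?_ ?_).trans_lt (by linarith)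
  · rintro u ⟨hu, hux⟩
    obtain ⟨v, hv, hvy, huv⟩ := h x y hxy u hu hux
    exact ⟨v, ⟨hv, hvy⟩, huv⟩
  · rintro v ⟨hv, hvy⟩
    obtain ⟨u, hu, hux, hvu⟩ := h y x (by rwa [dist_comm]) v hv hvy
    exact ⟨u, ⟨hu, hux⟩, hvu⟩
end

section
/- Let (X,d) be a compact metric space and F : X → 2^X a continuous set-valued map with nonempty compact values. Then the projection map π₀ : Orb_r(X) → X, (x_n) ↦ x₀, is an open map. -/
open Metric Set

variable {X : Type*} [MetricSpace X]

/-- A set-valued map with nonempty values has an orbit starting at every point. -/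
theorem exists_mem_OrbR_zero_eq {Y : Type*} {F : Y → Set Y} (hF : ∀ x, (F x).Nonempty) (y : Y) :
    ∃ v ∈ OrbR F, v 0 = y := by
  choose f hf using hF
  refine ⟨fun n => f^[n] y, fun n => ?_, rfl⟩
  simpa only [Function.iterate_succ_apply'] using hf (f^[n] y)

/-- Prepending `y` to an orbit that starts in `F y` gives an orbit. -/
theorem cons_mem_OrbR {Y : Type*} {F : Y → Set Y} {v : ℕ → Y} (hv : v ∈ OrbR F) {y : Y}
    (hy : v 0 ∈ F y) :
    (fun n => Nat.casesOn n y v : ℕ → Y) ∈ OrbR F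
  | 0 => hy
  | n + 1 => hv n

/-- For a lower semicontinuous map with nonempty values, every point near the start of an orbit
starts an orbit that stays near the given one during its first `N` steps. -/
theorem SVLowerSC.eventually_exists_mem_OrbR {F : X → Set X} (hF : SVLowerSC F)
    (hne : ∀ x, (F x).Nonempty) (N : ℕ) {u : ℕ → X} (hu : u ∈ OrbR F) {W : ℕ → Set X}
    (hW : ∀ n, W n ∈ nhds (u n)) :
    ∀ᶠ y in nhds (u 0), ∃ v ∈ OrbR F, v 0 = y ∧ ∀ n < N, v n ∈ W n := by
  induction N generalizing u W with
  | zero =>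
    refine Filter.Eventually.of_forall fun y => ?_
    obtain ⟨v, hv, hv0⟩ := exists_mem_OrbR_zero_eq hne y
    exact ⟨v, hv, hv0, by simp⟩
  | succ N ih =>
    obtain ⟨U, hU, hUo, huU⟩ := _root_.eventually_nhds_iff.1
      (ih (u := fun n => u (n + 1)) (fun n => hu (n + 1)) (fun n => hW (n + 1)))
    obtain ⟨V, hVo, huV, hV⟩ := hF (u 0) U hUo ⟨u 1, hu 0, huU⟩
    filter_upwards [hVo.mem_nhds huV, hW 0] with y hyV hyW
    obtain ⟨z, hzF, hzU⟩ := hV y hyV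
    obtain ⟨v, hv, rfl, hvW⟩ := hU z hzU
    refine ⟨_, cons_mem_OrbR hv hzF, rfl, ?_⟩
    rintro (_ | n) hn
    · exact hyW
    · exact hvW n (by omega)

/-- For a continuous set-valued map `F` with nonempty compact values on a
compact metric space, the projection `π₀ : Orb_r(X) → X`, `(x_n) ↦ x₀`, is an open map. -/
theorem projection_isOpenMap [CompactSpace X]
    (F : X → Set X) (hF : SVContinuous F) (hFc : SVCompactValued F) :
    IsOpenMap (fun u : OrbR F => u.1 0) := by
  refine isOpenMap_iff_nhds_le.2 fun u => ?_
  intro S hS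
  obtain ⟨T, hTS, hT, huT⟩ := mem_nhds_iff.1 (Filter.mem_map.1 hS)
  obtain ⟨T', hT', rfl⟩ := isOpen_induced_iff.1 hT
  obtain ⟨I, W, hW, hWT⟩ := isOpen_pi_iff.1 hT' u.1 huT
  classical
  have hW' : ∀ n, (if n ∈ I then W n else univ) ∈ nhds (u.1 n) := by
    intro n
    split_ifs with hn
    · exact (hW n hn).1.mem_nhds (hW n hn).2
    · exact Filter.univ_mem
  filter_upwards [hF.2.eventually_exists_mem_OrbR (fun x => (hFc x).1) (I.sup id + 1) u.2 hW']
    with y ⟨v, hv, hvy, hvW⟩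
  have hvS : (⟨v, hv⟩ : OrbR F) ∈ (fun u : OrbR F => u.1 0) ⁻¹' S := by
    refine hTS (hWT fun n hn => ?_)
    have hn' : n ∈ I := hn
    simpa [hn'] using hvW n (Nat.lt_succ_of_le (Finset.le_sup (f := id) hn'))
  exact hvy ▸ hvS
end

section
/- Let (X,d) be a compact metric space and F : X → 2^X an upper semicontinuous set-valued map with nonempty compact values which is onto. Then F is open if and only if the inverse set-valued map F⁻¹, defined by F⁻¹(x) = {z ∈ X : x ∈ F(z)}, is continuous. -/
open Metric Set

variable {X : Type*} [MetricSpace X]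

omit [MetricSpace X] in
lemma inv_inter_nonempty_iff (F : X → Set X) (U : Set X) (y : X) :
    (SVInv F y ∩ U).Nonempty ↔ y ∈ SVImage F U := by
  simp [SVInv, SVImage, Set.Nonempty, and_comm]

/-- An upper semicontinuous map with compact values has a closed graph. -/
lemma SVUpperSC.isClosed_graph {F : X → Set X} (hF : SVUpperSC F)
    (hFc : ∀ x, IsCompact (F x)) : IsClosed {p : X × X | p.2 ∈ F p.1} := by
  rw [← isOpen_compl_iff, isOpen_prod_iff]
  intro x y hxy
  obtain ⟨U, W, hU, hW, hFU, hyW, hUW⟩ :=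
    SeparatedNhds.of_isCompact_isCompact (hFc x) isCompact_singleton
      (Set.disjoint_singleton_right.2 hxy)
  obtain ⟨V, hV, hxV, hVU⟩ := hF x U hU hFU
  refine ⟨V, W, hV, hW, hxV, hyW rfl, ?_⟩
  rintro ⟨a, b⟩ ⟨ha, hb⟩ hab
  exact Set.disjoint_left.1 hUW (hVU a ha hab) hb

lemma SVUpperSC.isClosed_image [CompactSpace X] {F : X → Set X} (hF : SVUpperSC F)
    (hFc : ∀ x, IsCompact (F x)) {C : Set X} (hC : IsClosed C) : IsClosed (SVImage F C) := by
  have himage : SVImage F C = Prod.snd '' ({p : X × X | p.2 ∈ F p.1} ∩ Prod.fst ⁻¹' C) := by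
    ext y
    simp [SVImage, and_comm]
  rw [himage]
  exact (((hF.isClosed_graph hFc).inter (hC.preimage continuous_fst)).isCompact.image
    continuous_snd).isClosed

lemma SVUpperSC.inv [CompactSpace X] {F : X → Set X} (hF : SVUpperSC F)
    (hFc : ∀ x, IsCompact (F x)) : SVUpperSC (SVInv F) := by
  intro x U hU hxU
  have key (y : X) : y ∈ (SVImage F Uᶜ)ᶜ ↔ SVInv F y ⊆ U := by
    rw [Set.mem_compl_iff, ← inv_inter_nonempty_iff, Set.inter_compl_nonempty_iff, not_not]
  exact ⟨(SVImage F Uᶜ)ᶜ, (hF.isClosed_image hFc hU.isClosed_compl).isOpen_compl,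
    (key x).2 hxU, fun y hy => (key y).1 hy⟩

lemma open_iff_inv_lowerSC (F : X → Set X) : SVOpen F ↔ SVLowerSC (SVInv F) := by
  simp only [SVOpen, SVLowerSC, inv_inter_nonempty_iff]
  constructor
  · intro h x U hU hx
    exact ⟨SVImage F U, h U hU, hx, fun y hy => hy⟩
  · intro h U hU
    refine isOpen_iff_forall_mem_open.2 fun x hx => ?_
    obtain ⟨V, hV, hxV, hVU⟩ := h x U hU hx
    exact ⟨V, hVU, hV, hxV⟩

/-- For an upper semicontinuous, onto set-valued map `F` with nonempty
compact values on a compact metric space, `F` is open iff `F⁻¹` is continuous. -/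
theorem open_iff_inv_continuous [CompactSpace X]
    (F : X → Set X) (hF : SVUpperSC F) (hFc : SVCompactValued F) (honto : SVOnto F) :
    SVOpen F ↔ SVContinuous (SVInv F) := by
  rw [open_iff_inv_lowerSC]
  exact ⟨fun h => ⟨hF.inv fun x => (hFc x).2, h⟩, fun h => h.2⟩
end

section
/- Let (X,d) be a compact metric space and F : X → 2^X an upper semicontinuous set-valued map with nonempty compact values. If F is open, then the shift maps σ_rF : Orb_r(X) → Orb_r(X), (x_n) ↦ (x_{n+1}), and σ_lF : Orb_l(X) → Orb_l(X), (x_{-n}) ↦ (x_{-n-1}), are both open maps. -/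
open Metric Set

variable {X : Type*} [MetricSpace X]

/-- The sequence `(x, v 0, v 1, …)`. -/
def consSeq (x : X) (v : ℕ → X) : ℕ → X
  | 0 => x
  | n + 1 => v n

theorem continuous_consSeq : Continuous fun p : X × (ℕ → X) => consSeq p.1 p.2 := by
  refine continuous_pi fun n => ?_
  cases n with
  | zero => exact continuous_fst
  | succ n => exact (continuous_apply n).comp continuous_snd

theorem consSeq_shiftSeq {Y : Type*} (u : ℕ → Y) : consSeq (u 0) (shiftSeq u) = u := by
  funext n
  cases n <;> rfl

theorem consSeq_mem_OrbR {Y : Type*} {F : Y → Set Y} {x : Y} {v : ℕ → Y} (hv : v ∈ OrbR F)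
    (hx : v 0 ∈ F x) : consSeq x v ∈ OrbR F := by
  intro n
  cases n with
  | zero => exact hx
  | succ n => exact hv n

/-- Openness of `F` lets one pull the first coordinate of a nearby orbit back to a point near
the original starting point, so the shift is open. -/
theorem isOpenMap_sigmaR {F : X → Set X} (hopen : SVOpen F) : IsOpenMap (sigmaR F) := by
  rintro O ⟨W, hW, rfl⟩
  rw [isOpen_iff_mem_nhds]
  rintro _ ⟨u, hu, rfl⟩
  have hmem : ((u.1 0, shiftSeq u.1) : X × (ℕ → X)) ∈
      (fun p : X × (ℕ → X) => consSeq p.1 p.2) ⁻¹' W := by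
    simpa [consSeq_shiftSeq] using hu
  obtain ⟨U, V, hU, hV, hu0, hsu, hUV⟩ :=
    isOpen_prod_iff.1 (hW.preimage continuous_consSeq) _ _ hmem
  have hcont : Continuous fun v : OrbR F => v.1 0 :=
    (continuous_apply 0).comp continuous_subtype_val
  have hN : IsOpen {v : OrbR F | v.1 ∈ V ∧ v.1 0 ∈ SVImage F U} :=
    (hV.preimage continuous_subtype_val).inter
      ((hopen U hU).preimage hcont)
  refine Filter.mem_of_superset
    (hN.mem_nhds ⟨hsu, mem_iUnion₂.2 ⟨u.1 0, hu0, u.2 0⟩⟩) ?_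
  rintro v ⟨hvV, hv0⟩
  obtain ⟨x, hxU, hx⟩ := mem_iUnion₂.1 hv0
  exact ⟨⟨consSeq x v.1, consSeq_mem_OrbR v.2 hx⟩, hUV (mk_mem_prod hxU hvV), rfl⟩

/-- If an upper semicontinuous set-valued map `F` with nonempty compact
values on a compact metric space is open, then the shift maps `σ_rF` on `Orb_r(X)` and
`σ_lF` on `Orb_l(X)` are open maps. -/
theorem shifts_isOpenMap_of_svOpen [CompactSpace X]
    (F : X → Set X) (hF : SVUpperSC F) (hFc : SVCompactValued F) (hopen : SVOpen F) :
    IsOpenMap (sigmaR F) ∧ IsOpenMap (sigmaL F) :=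
  ⟨isOpenMap_sigmaR hopen, isOpenMap_sigmaR hopen⟩
end

section
/- Let (X,d) be a compact metric space and F : X → 2^X a continuous set-valued map with nonempty compact values. If the shift map σ_rF : Orb_r(X) → Orb_r(X), (x_n) ↦ (x_{n+1}), is open, then F is an open set-valued map. -/
open Metric Set

variable {X : Type*} [MetricSpace X]

theorem exists_mem_orbR_apply_zero {Y : Type*} {F : Y → Set Y}
    (hne : ∀ x, (F x).Nonempty) (x : Y) :
    ∃ v ∈ OrbR F, v 0 = x := by
  choose f hf using hne
  exact ⟨fun n => f^[n] x, fun n => by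
    simpa only [Function.iterate_succ_apply'] using hf (f^[n] x), rfl⟩

/-- Prepending a point `x` with `v 0 ∈ F x` to an orbit `v` gives an orbit. -/
theorem cons_mem_orbR {Y : Type*} {F : Y → Set Y} {v : ℕ → Y}
    (hv : v ∈ OrbR F) {x : Y} (hx : v 0 ∈ F x) : (fun n => Nat.casesOn n x v : ℕ → Y) ∈ OrbR F := by
  rintro (_ | n)
  · exact hx
  · exact hv n

/-- For lower semicontinuous `F`, an orbit through finitely many prescribed open sets can be
followed from every starting point near its own. -/
theorem SVLowerSC.exists_isOpen_forall_exists_mem_orbR {F : X → Set X} (hF : SVLowerSC F)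
    (hne : ∀ x, (F x).Nonempty) (n : ℕ) {u : ℕ → X} (hu : u ∈ OrbR F) {U : ℕ → Set X}
    (hU : ∀ i, IsOpen (U i)) (huU : ∀ i, u i ∈ U i) :
    ∃ V : Set X, IsOpen V ∧ u 0 ∈ V ∧
      ∀ y ∈ V, ∃ v ∈ OrbR F, v 0 = y ∧ ∀ i < n, v i ∈ U i := by
  induction n generalizing u U with
  | zero =>
    refine ⟨univ, isOpen_univ, mem_univ _, fun y _ => ?_⟩
    obtain ⟨v, hv, hv0⟩ := exists_mem_orbR_apply_zero hne y
    exact ⟨v, hv, hv0, fun i hi => absurd hi (Nat.not_lt_zero i)⟩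
  | succ n ih =>
    obtain ⟨N, hN, huN, hNv⟩ := ih (u := fun i => u (i + 1)) (fun i => hu (i + 1))
      (U := fun i => U (i + 1)) (fun i => hU (i + 1)) (fun i => huU (i + 1))
    obtain ⟨V, hV, huV, hVN⟩ := hF (u 0) N hN ⟨u 1, hu 0, huN⟩
    refine ⟨V ∩ U 0, hV.inter (hU 0), ⟨huV, huU 0⟩, fun y hy => ?_⟩
    obtain ⟨z, hzF, hzN⟩ := hVN y hy.1
    obtain ⟨v, hv, rfl, hvU⟩ := hNv z hzN
    refine ⟨_, cons_mem_orbR hv hzF, rfl, ?_⟩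
    rintro (_ | i) hi
    · exact hy.2
    · exact hvU i (Nat.lt_of_succ_lt_succ hi)

/-- For lower semicontinuous `F`, the projection of the orbit space to the initial point is an
open map. -/
theorem SVLowerSC.isOpenMap_orbR_apply_zero {F : X → Set X} (hF : SVLowerSC F)
    (hne : ∀ x, (F x).Nonempty) : IsOpenMap (fun u : OrbR F => u.1 0) := by
  classical
  rintro _ ⟨T, hT, rfl⟩
  rw [isOpen_iff_forall_mem_open]
  rintro _ ⟨u, huT, rfl⟩
  obtain ⟨I, W, hW, hWT⟩ := isOpen_pi_iff.1 hT u.1 huT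
  obtain ⟨V, hV, huV, hVv⟩ := hF.exists_isOpen_forall_exists_mem_orbR hne (I.sup id + 1) u.2
    (U := fun i => if i ∈ I then W i else univ)
    (fun i => by
      by_cases hi : i ∈ I
      · simpa [hi] using (hW i hi).1
      · simp [hi])
    (fun i => by
      by_cases hi : i ∈ I
      · simpa [hi] using (hW i hi).2
      · simp [hi])
  refine ⟨V, fun y hy => ?_, hV, huV⟩
  obtain ⟨v, hv, hv0, hvU⟩ := hVv y hy
  refine ⟨⟨v, hv⟩, hWT fun i hi => ?_, hv0⟩
  have hiI : i ∈ I := hi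
  simpa [hiI] using hvU i (Nat.lt_succ_of_le (Finset.le_sup (f := id) hiI))

/-- If `F` is a continuous set-valued map with nonempty compact values on a
compact metric space and the shift `σ_rF` on `Orb_r(X)` is an open map, then `F` is open. -/
theorem svOpen_of_shift_isOpenMap [CompactSpace X]
    (F : X → Set X) (hF : SVContinuous F) (hFc : SVCompactValued F)
    (hshift : IsOpenMap (sigmaR F)) :
    SVOpen F := by
  intro U hU
  have hne : ∀ x, (F x).Nonempty := fun x => (hFc x).1
  have hW : IsOpen {u : OrbR F | u.1 0 ∈ U} :=
    hU.preimage ((continuous_apply 0).comp continuous_subtype_val)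
  convert hF.2.isOpenMap_orbR_apply_zero hne _ (hshift _ hW) using 1
  ext y
  simp only [SVImage, mem_iUnion, exists_prop]
  constructor
  · rintro ⟨x, hxU, hy⟩
    obtain ⟨v, hv, rfl⟩ := exists_mem_orbR_apply_zero hne y
    exact ⟨_, ⟨⟨_, cons_mem_orbR hv hy⟩, hxU, rfl⟩, rfl⟩
  · rintro ⟨_, ⟨u, huU, rfl⟩, rfl⟩
    exact ⟨u.1 0, huU, u.2 0⟩
end

section
/- Let 0 ≤ a ≤ b and let f : [a,b] → [a,b] be a continuous single-valued map, where [a,b] carries the Euclidean metric. Define the set-valued map F on [-b,-a] ∪ [a,b] by F(x) = {f(-x), -f(-x)} for x ∈ [-b,-a] and F(x) = {f(x), -f(x)} for x ∈ [a,b]. If f has the shadowing property, then F has the shadowing property (as a set-valued map). -/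
open Metric Set

variable {X : Type*} [MetricSpace X]

theorem abs_mem_Icc_iff_of_nonneg {a b x : ℝ} (ha : 0 ≤ a) :
    |x| ∈ Icc a b ↔ x ∈ Icc (-b) (-a) ∪ Icc a b := by
  simp only [mem_Icc, mem_union]
  grind

theorem dist_abs_lt_of_infDist_pair_neg_lt {p x δ : ℝ} (hp : 0 ≤ p)
    (h : infDist x ({p, -p} : Set ℝ) < δ) : dist p |x| < δ := by
  obtain ⟨q, hq, hxq⟩ := (infDist_lt_iff (insert_nonempty p {-p})).1 h
  have hq_abs : |q| = p := by
    rcases hq with rfl | rfl <;> simp [abs_of_nonneg hp]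
  rw [← hq_abs, dist_comm]
  exact (abs_abs_sub_abs_le x q).trans_lt hxq

/-- Let `0 ≤ a ≤ b` and `f : [a,b] → [a,b]` be continuous with the shadowing
property. Define the set-valued map `F` on `[-b,-a] ∪ [a,b]` by `F(x) = {f(-x), -f(-x)}` for
`x ∈ [-b,-a]` and `F(x) = {f(x), -f(x)}` for `x ∈ [a,b]` (uniformly, `F x = {f |x|, -f |x|}`).
Then `F` has the shadowing property as a set-valued map on `[-b,-a] ∪ [a,b]`. -/
theorem symmetrized_map_shadowing (a b : ℝ) (ha : 0 ≤ a) (hab : a ≤ b) (f : ℝ → ℝ)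
    (hf : ContinuousOn f (Icc a b)) (hmaps : MapsTo f (Icc a b) (Icc a b))
    (hshadow : ∀ ε > (0 : ℝ), ∃ δ > (0 : ℝ), ∀ x : ℕ → ℝ,
      (∀ n : ℕ, x n ∈ Icc a b) →
      (∀ n : ℕ, dist (f (x n)) (x (n + 1)) < δ) →
      ∃ z ∈ Icc a b, ∀ n : ℕ, dist (f^[n] z) (x n) < ε) :
    ∀ ε > (0 : ℝ), ∃ δ > (0 : ℝ), ∀ x : ℕ → ℝ,
      (∀ n : ℕ, x n ∈ Icc (-b) (-a) ∪ Icc a b) →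
      (∀ n : ℕ, infDist (x (n + 1)) ({f |x n|, -f |x n|} : Set ℝ) < δ) →
      ∃ y : ℕ → ℝ, (∀ n : ℕ, y n ∈ Icc (-b) (-a) ∪ Icc a b) ∧
        (∀ n : ℕ, y (n + 1) ∈ ({f |y n|, -f |y n|} : Set ℝ)) ∧
        ∀ n : ℕ, dist (x n) (y n) < ε := by
  intro ε hε
  obtain ⟨δ, hδ, hδ_shadow⟩ := hshadow ε hε
  refine ⟨δ, hδ, fun x hx hpseudo => ?_⟩
  have habs (n : ℕ) : |x n| ∈ Icc a b := (abs_mem_Icc_iff_of_nonneg ha).2 (hx n)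
  obtain ⟨z, hz, hzx⟩ := hδ_shadow (fun n => |x n|) habs fun n =>
    dist_abs_lt_of_infDist_pair_neg_lt (ha.trans (hmaps (habs n)).1) (hpseudo n)
  have horbit (n : ℕ) : f^[n] z ∈ Icc a b := hmaps.iterate n hz
  let y : ℕ → ℝ := fun n => if 0 ≤ x n then f^[n] z else -f^[n] z
  have hy_abs (n : ℕ) : |y n| = f^[n] z := by
    have := abs_of_nonneg (ha.trans (horbit n).1)
    dsimp only [y]
    split_ifs <;> simp [this]
  refine ⟨y, fun n => ?_, fun n => ?_, fun n => ?_⟩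
  · rw [← abs_mem_Icc_iff_of_nonneg ha, hy_abs]
    exact horbit n
  · rw [hy_abs, ← Function.iterate_succ_apply' f n z]
    dsimp only [y]
    split_ifs <;> simp
  · have hn := hzx n
    dsimp only [y]
    rw [Real.dist_eq] at hn ⊢
    grind
end

section
/- Let (X,d) be a compact metric space and F : X → 2^X a continuous onto set-valued map with nonempty compact values. If F has the shadowing property, then the inverse set-valued map F⁻¹, defined by F⁻¹(x) = {z ∈ X : x ∈ F(z)}, also has the shadowing property. -/
open Metric Set

variable {X : Type*} [MetricSpace X]

/-- An upper semicontinuous set-valued map with compact values has closed graph. -/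
theorem SVUpperSC.isClosed_graph_s7 {F : X → Set X} (hF : SVUpperSC F) (hFc : SVCompactValued F) :
    IsClosed {q : X × X | q.2 ∈ F q.1} := by
  rw [← isOpen_compl_iff, isOpen_iff_mem_nhds]
  rintro ⟨z, p⟩ hp
  obtain ⟨U, W, hU, hW, hFU, hpW, hUW⟩ : SeparatedNhds (F z) {p} :=
    SeparatedNhds.of_isCompact_isCompact (hFc z).2 isCompact_singleton (disjoint_singleton_right.2 hp)
  obtain ⟨V, hV, hzV, hVU⟩ := hF z U hU hFU
  filter_upwards [(hV.prod hW).mem_nhds ⟨hzV, hpW rfl⟩] with q hq hmem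
  exact disjoint_left.1 hUW (hVU _ hq.1 hmem) hq.2

/-- A lower semicontinuous set-valued map with compact graph is uniformly lower semicontinuous. -/
theorem SVLowerSC.exists_uniform_infDist_lt {F : X → Set X} (hF : SVLowerSC F)
    (hK : IsCompact {q : X × X | q.2 ∈ F q.1}) {η : ℝ} (hη : 0 < η) :
    ∃ δ > (0 : ℝ), ∀ x z p : X, dist x z < δ → p ∈ F z → infDist p (F x) < η := by
  have key : ∀ q : {q : X × X | q.2 ∈ F q.1}, ∃ V : Set X, IsOpen V ∧ q.1.1 ∈ V ∧
      ∀ y ∈ V, (F y ∩ ball q.1.2 (η / 2)).Nonempty := fun q =>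
    hF q.1.1 _ isOpen_ball ⟨q.1.2, q.2, mem_ball_self (half_pos hη)⟩
  choose V hV hmem hVF using key
  obtain ⟨δ, hδ, H⟩ := lebesgue_number_lemma_of_metric hK
    (c := fun q => V q ×ˢ ball q.1.2 (η / 2)) (fun q => (hV q).prod isOpen_ball)
    (fun q hq => mem_iUnion.2 ⟨⟨q, hq⟩, hmem ⟨q, hq⟩, mem_ball_self (half_pos hη)⟩)
  refine ⟨δ, hδ, fun x z p hxz hp => ?_⟩
  obtain ⟨q, hq⟩ := H (z, p) hp
  have hxp : (x, p) ∈ ball (z, p) δ := by simpa [Prod.dist_eq, hδ] using hxz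
  obtain ⟨hxV, hpq⟩ := hq hxp
  obtain ⟨y, hyF, hyq⟩ := hVF q x hxV
  calc infDist p (F x) ≤ dist p y := infDist_le_dist_of_mem hyF
    _ ≤ dist p q.1.2 + dist y q.1.2 := dist_triangle_right _ _ _
    _ < η / 2 + η / 2 := add_lt_add hpq hyq
    _ = η := add_halves η

/-- A sequence which is a backward pseudo-orbit of a set-valued map with shadowing is shadowed on
every finite initial segment by a backward orbit segment. -/
theorem exists_backward_orbit_segment {F : X → Set X} (hFc : SVCompactValued F) {ε η : ℝ}
    (hη : 0 < η)
    (hsh : ∀ x : ℕ → X, (∀ n, infDist (x (n + 1)) (F (x n)) < η) →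
      ∃ y : ℕ → X, (∀ n, y (n + 1) ∈ F (y n)) ∧ ∀ n, dist (x n) (y n) < ε)
    {x : ℕ → X} (hx : ∀ n, infDist (x n) (F (x (n + 1))) < η) (N : ℕ) :
    ∃ w : ℕ → X, ∀ n < N, w n ∈ F (w (n + 1)) ∧ dist (x n) (w n) < ε := by
  choose f hf using fun x => (hFc x).1
  obtain ⟨y, hy, hxy⟩ := hsh (fun k => f^[k - N] (x (N - k))) fun k => by
    rcases lt_or_ge k N with hk | hk
    · obtain ⟨m, rfl⟩ := Nat.exists_eq_add_of_lt hk
      have h₁ : k + m + 1 - (k + 1) = m := by omega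
      have h₂ : k + m + 1 - k = m + 1 := by omega
      have h₃ : k + 1 - (k + m + 1) = 0 := by omega
      have h₄ : k - (k + m + 1) = 0 := by omega
      simpa only [h₁, h₂, h₃, h₄, Function.iterate_zero, id] using hx m
    · have h₁ : k + 1 - N = k - N + 1 := by omega
      have h₂ : N - (k + 1) = 0 := by omega
      have h₃ : N - k = 0 := by omega
      simp only [h₁, h₂, h₃, Function.iterate_succ_apply']
      rwa [infDist_zero_of_mem (hf _)]
  refine ⟨fun n => y (N - n), fun n hn => ⟨?_, ?_⟩⟩
  · have h := hy (N - (n + 1))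
    rwa [show N - (n + 1) + 1 = N - n by omega] at h
  · have h := hxy (N - n)
    rwa [show N - n - N = 0 by omega, show N - (N - n) = n by omega] at h

/-- If `F` is a continuous onto set-valued map with nonempty compact values
on a compact metric space and `F` has the shadowing property, then `F⁻¹` has the shadowing
property. -/
theorem inv_shadowing_of_shadowing [CompactSpace X]
    (F : X → Set X) (hF : SVContinuous F) (hFc : SVCompactValued F) (honto : SVOnto F)
    (hsh : SVShadowing F) :
    SVShadowing (SVInv F) := by
  intro ε hε
  obtain ⟨η, hη, hsh⟩ := hsh (ε / 2) (half_pos hε)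
  have hK := hF.1.isClosed_graph_s7 hFc
  obtain ⟨δ, hδ, hunif⟩ := hF.2.exists_uniform_infDist_lt hK.isCompact hη
  refine ⟨δ, hδ, fun x hx => ?_⟩
  have hback : ∀ n, infDist (x n) (F (x (n + 1))) < η := fun n => by
    obtain ⟨z, hz, hxz⟩ := (infDist_lt_iff (honto (x n))).1 (hx n)
    exact hunif _ z _ hxz hz
  let C : ℕ → Set (ℕ → X) := fun N =>
    {w | ∀ n < N, w n ∈ F (w (n + 1)) ∧ dist (x n) (w n) ≤ ε / 2}
  have hC : ∀ N, IsClosed (C N) := fun N => by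
    simp only [C, ofPred_forall]
    refine isClosed_iInter fun n => isClosed_iInter fun _ => IsClosed.and ?_ ?_
    · exact IsClosed.preimage (f := fun w : ℕ → X => (w (n + 1), w n)) (by fun_prop) hK
    · exact isClosed_le (continuous_const.dist (continuous_apply n)) continuous_const
  obtain ⟨w, hw⟩ := IsCompact.nonempty_iInter_of_sequence_nonempty_isCompact_isClosed C
    (fun N w hw n hn => hw n (hn.trans N.lt_succ_self))
    (fun N => (exists_backward_orbit_segment hFc hη hsh hback N).imp
      fun w hw n hn => ⟨(hw n hn).1, (hw n hn).2.le⟩)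
    (hC 0).isCompact hC
  have hw' := fun n => mem_iInter.1 hw (n + 1) n n.lt_succ_self
  exact ⟨w, fun n => (hw' n).1, fun n => (hw' n).2.trans_lt (half_lt_self hε)⟩
end

section
/- Let (X,d) be a compact metric space of diameter at most 1 and F : X → 2^X a continuous set-valued map with nonempty compact values. Then F has the shadowing property (in the set-valued sense) if and only if the shift map σ_rF on (Orb_r(X), ρ) has the shadowing property (in the single-valued sense). -/
open Metric Set

variable {X : Type*} [MetricSpace X]

theorem shiftSeq_iterate_apply {Y : Type*} (u : ℕ → Y) (n k : ℕ) : shiftSeq^[n] u k = u (n + k) := by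
  induction n generalizing u with
  | zero => simp
  | succ n ih =>
    rw [Function.iterate_succ_apply, ih, shiftSeq]
    congr 1
    omega

theorem summable_dist_div_two_pow [CompactSpace X] (hdiam : diam (univ : Set X) ≤ 1)
    (u v : ℕ → X) : Summable fun n => dist (u n) (v n) / 2 ^ (n + 1) := by
  refine Summable.of_nonneg_of_le (fun n => by positivity) (fun n => ?_)
    (summable_geometric_two' 1)
  rw [div_div, ← pow_succ']
  gcongr
  exact (dist_le_diam_of_mem isCompact_univ.isBounded (mem_univ _) (mem_univ _)).trans hdiam

theorem dist_le_two_pow_mul_rho [CompactSpace X] (hdiam : diam (univ : Set X) ≤ 1)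
    (u v : ℕ → X) (k : ℕ) : dist (u k) (v k) ≤ 2 ^ (k + 1) * rho u v := by
  have h : dist (u k) (v k) / 2 ^ (k + 1) ≤ rho u v :=
    (summable_dist_div_two_pow hdiam u v).le_tsum k fun j _ => by positivity
  rwa [div_le_iff₀' (by positivity)] at h

/-- Sequences which are `η`-close in their first `N` coordinates are `(η + 2⁻ᴺ)`-close for `ρ`. -/
theorem rho_le_add_of_forall_lt [CompactSpace X] (hdiam : diam (univ : Set X) ≤ 1)
    {u v : ℕ → X} {η : ℝ} (hη : 0 ≤ η) {N : ℕ} (h : ∀ k < N, dist (u k) (v k) ≤ η) :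
    rho u v ≤ η + (1 / 2) ^ N := by
  have hs := summable_dist_div_two_pow hdiam u v
  rw [rho, ← hs.sum_add_tsum_nat_add N]
  refine add_le_add ?_ ?_
  · calc ∑ k ∈ Finset.range N, dist (u k) (v k) / 2 ^ (k + 1)
        ≤ ∑ k ∈ Finset.range N, η / 2 / 2 ^ k := by
          refine Finset.sum_le_sum fun k hk => ?_
          rw [div_div, ← pow_succ']
          gcongr
          exact h k (Finset.mem_range.mp hk)
      _ ≤ ∑' k, η / 2 / 2 ^ k :=
          (summable_geometric_two' η).sum_le_tsum _ fun k _ => by positivity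
      _ = η := tsum_geometric_two' η
  · rw [← tsum_geometric_two' ((1 / 2 : ℝ) ^ N)]
    refine ((summable_nat_add_iff N).mpr hs).tsum_le_tsum (fun k => ?_)
      (summable_geometric_two' _)
    have hd : dist (u (k + N)) (v (k + N)) ≤ 1 :=
      (dist_le_diam_of_mem isCompact_univ.isBounded (mem_univ _) (mem_univ _)).trans hdiam
    calc dist (u (k + N)) (v (k + N)) / 2 ^ (k + N + 1) ≤ 1 / 2 ^ (k + N + 1) := by gcongr
      _ = (1 / 2) ^ N / 2 / 2 ^ k := by
          rw [one_div_pow, pow_succ, pow_add]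
          field_simp

theorem SVContinuous.continuous_infDist {F : X → Set X} (hF : SVContinuous F)
    (hne : ∀ x, (F x).Nonempty) (p : X) : Continuous fun x => infDist p (F x) := by
  refine continuous_iff_continuousAt.mpr fun x => tendsto_order.mpr ⟨fun c hc => ?_, fun c hc => ?_⟩
  · obtain ⟨c', hcc', hc'⟩ := exists_between hc
    obtain ⟨V, hV, hxV, hVF⟩ := hF.1 x {q | c' < dist p q}
      (isOpen_lt continuous_const (continuous_const.dist continuous_id))
      fun q hq => hc'.trans_le (infDist_le_dist_of_mem hq)
    filter_upwards [hV.mem_nhds hxV] with y hy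
    exact hcc'.trans_le ((le_infDist (hne y)).mpr fun q hq => (hVF y hy hq).le)
  · obtain ⟨q, hq, hpq⟩ := (infDist_lt_iff (hne x)).mp hc
    obtain ⟨V, hV, hxV, hVF⟩ := hF.2 x (ball p c) isOpen_ball ⟨q, hq, mem_ball'.mpr hpq⟩
    filter_upwards [hV.mem_nhds hxV] with y hy
    obtain ⟨r, hr, hrp⟩ := hVF y hy
    exact (infDist_lt_iff (hne y)).mpr ⟨r, hr, mem_ball'.mp hrp⟩

/-- A continuous set-valued map on a compact space is uniformly continuous for the Hausdorff
distance. -/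
theorem SVContinuous.exists_infDist_lt [CompactSpace X] {F : X → Set X} (hF : SVContinuous F)
    (hne : ∀ x, (F x).Nonempty) {η : ℝ} (hη : 0 < η) :
    ∃ δ > 0, ∀ a b : X, dist a b < δ → ∀ p ∈ F b, infDist p (F a) < η := by
  have hcont : Continuous fun q : X × X => infDist q.2 (F q.1) :=
    continuous_prod_of_continuous_lipschitzWith' _ 1 (fun a => lipschitz_infDist_pt (F a))
      fun p => hF.continuous_infDist hne p
  obtain ⟨δ, hδ, h⟩ := Metric.uniformContinuous_iff.mp
    (CompactSpace.uniformContinuous_of_continuous hcont) η hη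
  refine ⟨δ, hδ, fun a b hab p hp => ?_⟩
  have hd := h (a := (a, p)) (b := (b, p)) (by simpa [Prod.dist_eq, hδ] using hab)
  rw [infDist_zero_of_mem hp, Real.dist_0_eq_abs] at hd
  exact (abs_lt.mp hd).2

/-- Every sequence extends to a sequence of orbits starting at its terms, each of which follows
the next one as closely as possible. -/
theorem exists_orbits_following {F : X → Set X} (hFc : SVCompactValued F) (x : ℕ → X) :
    ∃ z : ℕ → ℕ → X, (∀ n, z n 0 = x n) ∧ (∀ n, z n ∈ OrbR F) ∧
      ∀ n k, dist (z n (k + 1)) (z (n + 1) k) = infDist (z (n + 1) k) (F (z n k)) := by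
  choose near hmem hdist using fun a p : X => (hFc a).2.exists_infDist_eq_dist (hFc a).1 p
  let Z : ℕ → ℕ → X := fun k =>
    Nat.rec x (fun _ u n => near (u n) (u (n + 1))) k
  exact ⟨fun n k => Z k n, fun _ => rfl, fun n k => hmem _ _,
    fun n k => (dist_comm _ _).trans (hdist (Z k n) (Z k (n + 1))).symm⟩

open Filter Topology in
/-- If orbits follow each other as closely as possible and their starting points form a
`δ`-pseudo-orbit with `δ` small, then they stay close at any prescribed time. -/
theorem SVContinuous.eventually_following_lt [CompactSpace X] {F : X → Set X}
    (hF : SVContinuous F) (hne : ∀ x, (F x).Nonempty) (k : ℕ) {η : ℝ} (hη : 0 < η) :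
    ∀ᶠ δ in 𝓝[>] (0 : ℝ), ∀ z : ℕ → ℕ → X, (∀ n, z n ∈ OrbR F) →
      (∀ n k, dist (z n (k + 1)) (z (n + 1) k) = infDist (z (n + 1) k) (F (z n k))) →
      (∀ n, infDist (z (n + 1) 0) (F (z n 0)) < δ) →
      ∀ n, dist (z n (k + 1)) (z (n + 1) k) < η := by
  induction k generalizing η with
  | zero =>
    filter_upwards [Ioc_mem_nhdsGT hη] with δ hδ z _ hz hx n
    exact (hz n 0).trans_lt ((hx n).trans_le hδ.2)
  | succ k ih =>
    obtain ⟨δ', hδ', h⟩ := hF.exists_infDist_lt hne hη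
    filter_upwards [ih hδ'] with δ hδ z horb hz hx n
    rw [hz n (k + 1)]
    exact h _ _ (hδ z horb hz hx n) _ (horb (n + 1) k)

theorem dist_apply_zero_le_of_rho_shiftSeq_le [CompactSpace X]
    (hdiam : diam (univ : Set X) ≤ 1) {z : ℕ → ℕ → X} {δ : ℝ} (hδ : 0 ≤ δ)
    (hz : ∀ n, rho (shiftSeq (z n)) (z (n + 1)) ≤ δ) (k n : ℕ) :
    dist (z n k) (z (n + k) 0) ≤ 2 ^ (k + 1) * δ := by
  induction k generalizing n with
  | zero => simpa using hδ
  | succ k ih =>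
    have h1 : dist (z n (k + 1)) (z (n + 1) k) ≤ 2 ^ (k + 1) * δ :=
      (dist_le_two_pow_mul_rho hdiam (shiftSeq (z n)) (z (n + 1)) k).trans
        (mul_le_mul_of_nonneg_left (hz n) (by positivity))
    have h2 := ih (n + 1)
    have h3 := dist_triangle (z n (k + 1)) (z (n + 1) k) (z (n + 1 + k) 0)
    rw [show n + (k + 1) = n + 1 + k by omega, pow_succ]
    linarith

theorem SVShadowing.shiftShadowingR [CompactSpace X] (hdiam : diam (univ : Set X) ≤ 1)
    {F : X → Set X} (h : SVShadowing F) : ShiftShadowingR F := by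
  intro ε hε
  obtain ⟨N, hN⟩ := exists_pow_lt_of_lt_one (show 0 < ε / 4 by positivity)
    (show (1 / 2 : ℝ) < 1 by norm_num)
  obtain ⟨δ₁, hδ₁, hsh⟩ := h (ε / 4) (by positivity)
  obtain ⟨δ, hδ, hδle⟩ := exists_between (show 0 < min (δ₁ / 2) (ε / 4 / 2 ^ N) by positivity)
  obtain ⟨hδ1, hδ2⟩ := lt_min_iff.mp hδle
  rw [lt_div_iff₀' (by positivity)] at hδ2
  refine ⟨δ, hδ, fun z horb hz => ?_⟩
  obtain ⟨y, hy, hyz⟩ := hsh (fun n => z n 0) fun n => by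
    have hd : dist (z n 1) (z (n + 1) 0) ≤ 2 ^ (0 + 1) * rho (shiftSeq (z n)) (z (n + 1)) :=
      dist_le_two_pow_mul_rho hdiam (shiftSeq (z n)) (z (n + 1)) 0
    have hi := infDist_le_dist_of_mem (x := z (n + 1) 0) (horb n 0)
    rw [dist_comm] at hi
    have hzn := hz n
    norm_num at hd hi
    linarith
  refine ⟨y, hy, fun n => ?_⟩
  have hclose : ∀ k < N, dist (shiftSeq^[n] y k) (z n k) ≤ ε / 4 + ε / 4 := fun k hk => by
    rw [shiftSeq_iterate_apply]
    have h1 := dist_apply_zero_le_of_rho_shiftSeq_le hdiam hδ.le (fun n => (hz n).le) k n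
    have h2 : (2 : ℝ) ^ (k + 1) * δ ≤ 2 ^ N * δ := by
      gcongr
      · norm_num
      · exact hk
    have h3 := hyz (n + k)
    have h4 := dist_triangle_right (y (n + k)) (z n k) (z (n + k) 0)
    rw [dist_comm (y (n + k)) (z (n + k) 0)] at h4
    linarith
  have := rho_le_add_of_forall_lt hdiam (by positivity) hclose
  linarith

theorem ShiftShadowingR.svShadowing [CompactSpace X] (hdiam : diam (univ : Set X) ≤ 1)
    {F : X → Set X} (hF : SVContinuous F) (hFc : SVCompactValued F) (h : ShiftShadowingR F) :
    SVShadowing F := by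
  intro ε hε
  obtain ⟨δ₀, hδ₀, hsh⟩ := h (ε / 2) (by positivity)
  obtain ⟨N, hN⟩ := exists_pow_lt_of_lt_one (show 0 < δ₀ / 2 by positivity)
    (show (1 / 2 : ℝ) < 1 by norm_num)
  obtain ⟨δ, hfol, hδ⟩ := (((Filter.eventually_all_finset (Finset.range N)).mpr fun k _ =>
    hF.eventually_following_lt (fun x => (hFc x).1) k (half_pos hδ₀)).and
      self_mem_nhdsWithin).exists
  refine ⟨δ, hδ, fun x hx => ?_⟩
  obtain ⟨z, hz0, horb, hz⟩ := exists_orbits_following hFc x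
  obtain ⟨w, hw, hwz⟩ := hsh z horb fun n => by
    have := rho_le_add_of_forall_lt hdiam (half_pos hδ₀).le (u := shiftSeq (z n))
      (v := z (n + 1)) fun k hk => (hfol k (Finset.mem_range.mpr hk) z horb hz
        (by simpa only [hz0] using hx) n).le
    linarith
  refine ⟨w, hw, fun n => ?_⟩
  have hd := dist_le_two_pow_mul_rho hdiam (shiftSeq^[n] w) (z n) 0
  rw [shiftSeq_iterate_apply, hz0, dist_comm, zero_add, pow_one, add_zero] at hd
  linarith [hwz n]

/-- For a continuous set-valued map `F` with nonempty compact values on a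
compact metric space of diameter at most 1, `F` has the shadowing property (set-valued sense)
iff the shift `σ_rF` on `(Orb_r(X), ρ)` has the shadowing property (single-valued sense). -/
theorem svShadowing_iff_shiftR_shadowing [CompactSpace X]
    (hdiam : diam (univ : Set X) ≤ 1)
    (F : X → Set X) (hF : SVContinuous F) (hFc : SVCompactValued F) :
    SVShadowing F ↔ ShiftShadowingR F :=
  ⟨fun h => h.shiftShadowingR hdiam, fun h => h.svShadowing hdiam hF hFc⟩
end
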